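/- If F : ℝ^n → ℝ is Lipschitz, then the two-point estimator g_μ(x) = ((F(x + μu) − F(x))/μ)·u with u ∼ N(0, I_n) is an unbiased estimator of the gradient of the Gaussian smoothing: E_u[g_μ(x)] = ∇F_μ(x), where F_μ(x) = E_u[F(x + μu)]. -/

import Mathlib

open MeasureTheory ProbabilityTheory

/-- The standard Gaussian measure N(0, Iₙ) on ℝⁿ. -/
noncomputable def stdGaussian (n : ℕ) : Measure (Fin n → ℝ) :=
  Measure.pi fun _ => gaussianReal 0 1

/-- The Gaussian smoothing F_μ(x) = E_{u ∼ N(0,I)}[F(x + μ u)]. -/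
noncomputable def gaussSmooth {n : ℕ} (F : (Fin n → ℝ) → ℝ) (μ : ℝ) (x : Fin n → ℝ) : ℝ :=
  ∫ u, F (x + μ • u) ∂(stdGaussian n)

/-- The Euclidean norm on ℝⁿ. -/
noncomputable def euclNorm {n : ℕ} (x : Fin n → ℝ) : ℝ :=
  Real.sqrt (∑ i, (x i)^2)

/-- The two-point Gaussian gradient estimator g_μ(x) = ((F(x+μu) − F(x))/μ) u. -/
noncomputable def twoPoint {n : ℕ} (F : (Fin n → ℝ) → ℝ) (μ : ℝ)
    (x u : Fin n → ℝ) : Fin n → ℝ :=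
  fun i => ((F (x + μ • u) - F x) / μ) * u i

/-- View a vector a ∈ ℝⁿ as the continuous linear functional v ↦ ⟨a, v⟩;
used to express gradients via HasFDerivAt. -/
noncomputable def toCLM {n : ℕ} (a : Fin n → ℝ) : (Fin n → ℝ) →L[ℝ] ℝ :=
  ∑ i, a i • (ContinuousLinearMap.proj i : (Fin n → ℝ) →L[ℝ] ℝ)


lemma aux_gauss1 (m : ℝ) :
    (gaussianReal 0 1).withDensity (fun x => ENNReal.ofReal (Real.exp (m * x - m ^ 2 / 2)))
      = gaussianReal m 1 := by
  rw [gaussianReal_of_var_ne_zero _ one_ne_zero, gaussianReal_of_var_ne_zero _ one_ne_zero,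
    ← withDensity_mul _ (by fun_prop) (by fun_prop)]
  congr 1
  funext x
  simp only [Pi.mul_apply, gaussianPDF]
  rw [← ENNReal.ofReal_mul (gaussianPDFReal_nonneg _ _ _)]
  congr 1
  simp only [gaussianPDFReal]
  rw [mul_assoc, ← Real.exp_add]
  congr 2
  simp
  ring

/-- Cameron–Martin density. -/
noncomputable def cmDens {n : ℕ} (h w : Fin n → ℝ) : ℝ :=
  Real.exp (∑ i, (h i * w i - h i ^ 2 / 2))

lemma aux_int1 (c d : ℝ) : Integrable (fun x => Real.exp (c * x - d)) (gaussianReal 0 1) := by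
  have := (integrable_exp_mul_gaussianReal (μ := 0) (v := 1) c).mul_const (Real.exp (-d))
  simpa [← Real.exp_add, sub_eq_add_neg] using this

lemma aux_gaussn {n : ℕ} (h : Fin n → ℝ) :
    (Measure.pi fun i => gaussianReal (h i) 1) =
      (stdGaussian n).withDensity (fun w => ENNReal.ofReal (cmDens h w)) := by
  apply Measure.pi_eq
  intro s hs
  rw [withDensity_apply _ (MeasurableSet.univ_pi hs), _root_.stdGaussian, Measure.restrict_pi_pi]
  simp only [cmDens, Real.exp_sum]
  have hi : ∀ i, Integrable (fun x => Real.exp (h i * x - h i ^ 2 / 2))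
      ((gaussianReal 0 1).restrict (s i)) := fun i => (aux_int1 _ _).restrict
  rw [← ofReal_integral_eq_lintegral_ofReal (Integrable.fintype_prod_dep hi)
    (ae_of_all _ fun w => Finset.prod_nonneg fun i _ => (Real.exp_pos _).le),
    integral_fintype_prod_eq_prod (fun i x => Real.exp (h i * x - h i ^ 2 / 2)),
    ENNReal.ofReal_prod_of_nonneg (fun i _ => integral_nonneg fun x => (Real.exp_pos _).le)]
  refine Finset.prod_congr rfl fun i _ => ?_
  rw [ofReal_integral_eq_lintegral_ofReal (hi i) (ae_of_all _ fun w => (Real.exp_pos _).le),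
    ← aux_gauss1 (h i), withDensity_apply _ (hs i)]

lemma aux_shift {n : ℕ} (h : Fin n → ℝ) (G : (Fin n → ℝ) → ℝ) (hG : Continuous G) :
    ∫ u, G (u + h) ∂(stdGaussian n) = ∫ w, cmDens h w * G w ∂(stdGaussian n) := by
  have hm : (stdGaussian n).map (fun u => u + h) = Measure.pi fun i => gaussianReal (h i) 1 := by
    have := Measure.pi_map_pi (μ := fun _ : Fin n => gaussianReal 0 1)
      (f := fun i (x : ℝ) => x + h i) (fun i => by fun_prop)
    simp only [gaussianReal_map_add_const, zero_add] at this
    exact this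
  have hc : Measurable (fun w => ENNReal.ofReal (cmDens h w)) := by
    unfold cmDens; fun_prop
  calc ∫ u, G (u + h) ∂(stdGaussian n) = ∫ w, G w ∂((stdGaussian n).map (fun u => u + h)) := by
        rw [integral_map (by fun_prop) hG.aestronglyMeasurable]
    _ = _ := by
        rw [hm, aux_gaussn, integral_withDensity_eq_integral_toReal_smul hc
          (ae_of_all _ fun _ => ENNReal.ofReal_lt_top)]
        refine integral_congr_ae (ae_of_all _ fun w => ?_)
        simp [ENNReal.toReal_ofReal (Real.exp_pos _).le, cmDens]

/-- The l1 norm. -/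
noncomputable def l1 {n : ℕ} (w : Fin n → ℝ) : ℝ := ∑ i, |w i|

lemma l1_nonneg {n : ℕ} (w : Fin n → ℝ) : 0 ≤ l1 w := Finset.sum_nonneg fun i _ => abs_nonneg _

lemma l1_cont {n : ℕ} : Continuous (l1 (n := n)) := by unfold l1; fun_prop

lemma aux_int_exp {n : ℕ} (c : ℝ) :
    Integrable (fun w => Real.exp (c * l1 w)) (stdGaussian n) := by
  simp only [l1, Finset.mul_sum, Real.exp_sum]
  exact Integrable.fintype_prod (f := fun _ x => Real.exp (c * |x|)) fun i =>
    integrable_exp_mul_abs (X := fun x : ℝ => x) (integrable_exp_mul_gaussianReal c)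
      (integrable_exp_mul_gaussianReal (-c))

lemma eucl_le_l1 {n : ℕ} (w : Fin n → ℝ) : euclNorm w ≤ l1 w := by
  unfold euclNorm
  rw [Real.sqrt_le_left (l1_nonneg w)]
  unfold l1
  have := Finset.sum_sq_le_sq_sum_of_nonneg (s := Finset.univ) (f := fun i => |w i|)
    (fun i _ => abs_nonneg _)
  simpa using this

lemma toCLM_apply {n : ℕ} (a v : Fin n → ℝ) : toCLM a v = ∑ i, a i * v i := by
  simp [toCLM]

lemma cmDens_deriv {n : ℕ} (h w : Fin n → ℝ) :
    HasFDerivAt (fun h => cmDens h w) (cmDens h w • toCLM (w - h)) h := by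
  unfold cmDens
  have h1 : HasFDerivAt (fun h : Fin n → ℝ => ∑ i, (h i * w i - h i ^ 2 / 2))
      (toCLM (w - h)) h := by
    unfold toCLM
    refine HasFDerivAt.fun_sum fun i _ => ?_
    have hp : HasFDerivAt (fun h : Fin n → ℝ => h i)
      (ContinuousLinearMap.proj i : (Fin n → ℝ) →L[ℝ] ℝ) h :=
      (ContinuousLinearMap.proj i : (Fin n → ℝ) →L[ℝ] ℝ).hasFDerivAt
    have hd : HasDerivAt (fun t : ℝ => t * w i - t ^ 2 / 2) (w i - h i) (h i) := by
      have := ((hasDerivAt_id (h i)).mul_const (w i)).sub (((hasDerivAt_id (h i)).pow 2).div_const 2)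
      refine this.congr_deriv ?_
      simp
    exact hd.comp_hasFDerivAt h hp
  exact h1.exp

lemma toCLM_norm {n : ℕ} (a : Fin n → ℝ) : ‖toCLM a‖ ≤ l1 a := by
  refine ContinuousLinearMap.opNorm_le_bound _ (l1_nonneg a) fun v => ?_
  rw [toCLM_apply, l1, Finset.sum_mul]
  refine (norm_sum_le _ _).trans (Finset.sum_le_sum fun i _ => ?_)
  rw [norm_mul, Real.norm_eq_abs]
  gcongr
  exact norm_le_pi_norm v i

lemma toCLM_cont {n : ℕ} : Continuous (toCLM (n := n)) := by
  unfold toCLM; fun_prop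

lemma cmDens_cont {n : ℕ} (h : Fin n → ℝ) : Continuous (cmDens h) := by
  unfold cmDens; fun_prop

lemma cmDens_bound {n : ℕ} (h w : Fin n → ℝ) (hh : ‖h‖ ≤ 1) : cmDens h w ≤ Real.exp (l1 w) := by
  unfold cmDens l1
  rw [Real.exp_le_exp]
  refine Finset.sum_le_sum fun i _ => ?_
  have h1 : |h i| ≤ 1 := (norm_le_pi_norm h i).trans hh
  have h2 : h i * w i ≤ |h i| * |w i| := by rw [← abs_mul]; exact le_abs_self _
  nlinarith [abs_nonneg (w i), sq_nonneg (h i)]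

lemma l1_sub_bound {n : ℕ} (h w : Fin n → ℝ) (hh : ‖h‖ ≤ 1) : l1 (w - h) ≤ l1 w + n := by
  unfold l1
  have : (n : ℝ) = ∑ i : Fin n, (1 : ℝ) := by simp
  rw [this, ← Finset.sum_add_distrib]
  refine Finset.sum_le_sum fun i _ => ?_
  have h1 : |h i| ≤ 1 := (norm_le_pi_norm h i).trans hh
  have := abs_sub (w i) (h i)
  simp only [Pi.sub_apply]
  linarith

instance {n : ℕ} : IsProbabilityMeasure (stdGaussian n) := by unfold _root_.stdGaussian; infer_instance

lemma aux_deriv {n : ℕ} (G : (Fin n → ℝ) → ℝ) (hG : Continuous G) (C : ℝ) (hC : 0 ≤ C)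
    (hb : ∀ w, |G w| ≤ C * l1 w) :
    Integrable (fun w => G w • toCLM w) (stdGaussian n) ∧
    HasFDerivAt (fun h : Fin n → ℝ => ∫ w, cmDens h w * G w ∂(stdGaussian n))
      (∫ w, G w • toCLM w ∂(stdGaussian n)) 0 := by
  have h0 : ∀ w : Fin n → ℝ, cmDens 0 w = 1 := by intro w; simp [cmDens]
  have hbd : ∀ w h : Fin n → ℝ, ‖h‖ ≤ 1 → ‖G w • (cmDens h w • toCLM (w - h))‖ ≤
      C * (n + 1) * Real.exp (3 * l1 w) := by
    intro w h hh
    have hl := l1_nonneg w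
    have he : l1 w ≤ Real.exp (l1 w) := by linarith [Real.add_one_le_exp (l1 w)]
    have he1 : 1 ≤ Real.exp (l1 w) := Real.one_le_exp hl
    rw [norm_smul, norm_smul, Real.norm_eq_abs, Real.norm_eq_abs,
      abs_of_pos (show 0 < cmDens h w from Real.exp_pos _)]
    have e1 : |G w| ≤ C * Real.exp (l1 w) := (hb w).trans (by gcongr)
    have e2 := cmDens_bound h w hh
    have hn : (0 : ℝ) ≤ n := n.cast_nonneg
    have e3 : ‖toCLM (w - h)‖ ≤ (n + 1) * Real.exp (l1 w) := by
      have := (toCLM_norm (w - h)).trans (l1_sub_bound h w hh)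
      nlinarith
    have e4 : Real.exp (3 * l1 w) = Real.exp (l1 w) * Real.exp (l1 w) * Real.exp (l1 w) := by
      rw [← Real.exp_add, ← Real.exp_add]; ring_nf
    have e5 : 0 ≤ cmDens h w := (Real.exp_pos _).le
    calc |G w| * (cmDens h w * ‖toCLM (w - h)‖)
        ≤ (C * Real.exp (l1 w)) * (Real.exp (l1 w) * ((n + 1) * Real.exp (l1 w))) := by gcongr
      _ = _ := by rw [e4]; ring
  have hbi : Integrable (fun w : Fin n → ℝ => C * (n + 1) * Real.exp (3 * l1 w)) (stdGaussian n) :=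
    (aux_int_exp 3).const_mul _
  have hcF : Continuous (fun w => G w • toCLM w) := hG.smul toCLM_cont
  have hF0 : Integrable (fun w => cmDens 0 w * G w) (stdGaussian n) := by
    refine ((aux_int_exp 1).const_mul C).mono'
      ((cmDens_cont 0).mul hG).aestronglyMeasurable (ae_of_all _ fun w => ?_)
    rw [h0, one_mul, one_mul, Real.norm_eq_abs]
    refine (hb w).trans ?_
    gcongr
    linarith [Real.add_one_le_exp (l1 w)]
  refine ⟨hbi.mono' hcF.aestronglyMeasurable (ae_of_all _ fun w => ?_), ?_⟩
  · simpa [h0] using hbd w 0 (by simp)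
  have key := hasFDerivAt_integral_of_dominated_of_fderiv_le (𝕜 := ℝ) (μ := stdGaussian n)
    (F := fun h w => cmDens h w * G w) (F' := fun h w => G w • (cmDens h w • toCLM (w - h)))
    (x₀ := 0) (s := Metric.ball 0 1) (bound := fun w => C * (n + 1) * Real.exp (3 * l1 w))
    (Metric.ball_mem_nhds _ one_pos)
    (Filter.Eventually.of_forall fun h => ((cmDens_cont h).mul hG).aestronglyMeasurable)
    hF0
    (by simpa only [h0, one_smul, sub_zero] using hcF.aestronglyMeasurable)
    (ae_of_all _ fun w h hh => hbd w h (by simpa using (mem_ball_zero_iff.1 hh).le))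
    hbi
    (ae_of_all _ fun w h _ => (cmDens_deriv h w).mul_const (G w))
  simpa only [h0, one_smul, sub_zero] using key

/-- for Lipschitz F, the smoothed function F_μ is differentiable and the
two-point estimator is unbiased for its gradient: E_u[g_μ(x)] = ∇F_μ(x). -/
theorem stmt12 {n : ℕ} (F : (Fin n → ℝ) → ℝ) (L₀ : ℝ)
    (hLip : ∀ x y : Fin n → ℝ, |F x - F y| ≤ L₀ * euclNorm (x - y))
    (μ : ℝ) (hμ : 0 < μ) (x : Fin n → ℝ) :
    HasFDerivAt (gaussSmooth F μ)
      (toCLM (fun i => ∫ u, twoPoint F μ x u i ∂(stdGaussian n))) x := by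
  have hL : ∀ a b, |F a - F b| ≤ |L₀| * l1 (a - b) := fun a b =>
    (hLip a b).trans (mul_le_mul (le_abs_self _) (eucl_le_l1 _) (Real.sqrt_nonneg _) (abs_nonneg _))
  have hFc : Continuous F := by
    rw [continuous_iff_continuousAt]
    intro a
    rw [ContinuousAt, tendsto_iff_norm_sub_tendsto_zero]
    refine squeeze_zero (fun _ => norm_nonneg _) (fun b => hL b a) ?_
    have : Continuous (fun b => |L₀| * l1 (b - a)) :=
      continuous_const.mul (l1_cont.comp (continuous_id.sub continuous_const))
    simpa [l1] using this.tendsto a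
  set G : (Fin n → ℝ) → ℝ := fun w => F (x + μ • w) - F x with hGdef
  have hGc : Continuous G := by fun_prop
  have hGb : ∀ w, |G w| ≤ (|L₀| * μ) * l1 w := by
    intro w
    refine (hL _ _).trans (le_of_eq ?_)
    simp [l1, abs_mul, abs_of_pos hμ, ← Finset.mul_sum, mul_assoc]
  obtain ⟨hGint, hder⟩ := aux_deriv G hGc (|L₀| * μ) (by positivity) hGb
  have hsm : gaussSmooth F μ = fun y =>
      F x + ∫ w, cmDens (μ⁻¹ • (y - x)) w * G w ∂(stdGaussian n) := by
    funext y
    rw [← aux_shift _ G hGc]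
    have hy : ∀ u, G (u + μ⁻¹ • (y - x)) = F (y + μ • u) - F x := by
      intro u
      simp only [hGdef]
      rw [smul_add, smul_inv_smul₀ hμ.ne']
      congr 2
      abel
    have hyi : Integrable (fun u => F (y + μ • u)) (stdGaussian n) := by
      have hi : Integrable (fun u => F (y + μ • u) - F y) (stdGaussian n) := by
        refine ((aux_int_exp 1).const_mul (|L₀| * μ)).mono'
          (by fun_prop) (ae_of_all _ fun w => ?_)
        refine (hL _ _).trans ?_
        have : l1 (y + μ • w - y) = μ * l1 w := by
          simp [l1, abs_mul, abs_of_pos hμ, ← Finset.mul_sum]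
        rw [this, one_mul, mul_assoc]
        gcongr
        linarith [Real.add_one_le_exp (l1 w)]
      have h2 := hi.add (integrable_const (F y))
      refine h2.congr (ae_of_all _ fun u => ?_)
      simp
    simp only [hy]
    rw [integral_sub hyi (integrable_const _)]
    simp [gaussSmooth]
  rw [hsm]
  have hlin : HasFDerivAt (fun y : Fin n → ℝ => μ⁻¹ • (y - x))
      (μ⁻¹ • ContinuousLinearMap.id ℝ (Fin n → ℝ)) x :=
    ((hasFDerivAt_id x).sub_const x).const_smul μ⁻¹
  have h00 : μ⁻¹ • (x - x) = 0 := by simp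
  have hcomp := HasFDerivAt.comp x (by rw [h00]; exact hder) hlin
  refine (hcomp.const_add (F x)).congr_fderiv ?_
  ext v
  rw [toCLM_apply]
  simp only [ContinuousLinearMap.comp_apply, ContinuousLinearMap.smul_apply,
    ContinuousLinearMap.id_apply, map_smul]
  rw [ContinuousLinearMap.integral_apply hGint]
  simp only [ContinuousLinearMap.smul_apply, toCLM_apply, smul_eq_mul, Finset.mul_sum]
  have hii : ∀ i, Integrable (fun w => G w * (w i)) (stdGaussian n) := by
    intro i
    have := hGint.apply_continuousLinearMap (Pi.single i 1)
    simpa [toCLM_apply, Pi.single_apply] using this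
  rw [integral_finset_sum _ fun i _ => by simpa [mul_assoc] using (hii i).mul_const (v i),
    Finset.mul_sum]
  refine Finset.sum_congr rfl fun i _ => ?_
  rw [← integral_const_mul, ← integral_mul_const]
  refine integral_congr_ae (ae_of_all _ fun w => ?_)
  simp only [twoPoint, hGdef]
  field_simp
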